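/- Let n ≥ 1, let p_1 > p_2 > … > p_{2n} be real numbers, and let a_1,…,a_{2n} ∈ {1,−1} with exactly n of the a_j equal to 1 and exactly n equal to −1 (a bipartite Dirichlet polynomial of length 2n). Define F(x) = Σ_{j=1}^{2n} a_j e^{p_j x} for x ∈ ℝ. Then F has only finitely many real zeros, and the sum over all real zeros x_0 of the order of the zero of F at x_0 is at most n. -/

import Mathlib

open MeasureTheory Metric Filter Set ENNReal

/-- The order of `x` as a zero of `F`: the least `k` with `F^{(k)}(x) ≠ 0`. -/
noncomputable def zeroOrder (F : ℝ → ℝ) (x : ℝ) : ℕ :=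
  sInf {k : ℕ | iteratedDeriv k F x ≠ 0}

/-- `G` is a sequence of successive derivatives; zeros of `G 0` counted with order number at most
`N`. -/
def ZB (G : ℕ → ℝ → ℝ) (N : ℕ) : Prop :=
  ∀ (S : Finset ℝ) (m : ℝ → ℕ), (∀ x ∈ S, ∀ k < m x, G k x = 0) → ∑ x ∈ S, m x ≤ N

lemma ZB.finite {G : ℕ → ℝ → ℝ} {N : ℕ} (h : ZB G N) : {x | G 0 x = 0}.Finite := by
  by_contra hinf
  obtain ⟨t, ht, hc⟩ := Set.Infinite.exists_subset_card_eq hinf (N + 1)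
  have := h t (fun _ => 1) (by
    intro x hx k hk
    have : k = 0 := by omega
    subst this
    exact ht hx)
  simp at this
  omega

lemma ZB.mono {G : ℕ → ℝ → ℝ} {N M : ℕ} (h : ZB G N) (hNM : N ≤ M) : ZB G M :=
  fun S m hS => (h S m hS).trans hNM

lemma ZB.rolle {G : ℕ → ℝ → ℝ} {N : ℕ} (c : ℝ)
    (hG : ∀ x, HasDerivAt (G 0) (G 1 x) x)
    (h : ZB (fun k x => G (k + 1) x - c * G k x) N) : ZB G (N + 1) := by
  classical
  intro S m hS
  set S' := S.filter (fun x => 0 < m x) with hS'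
  have hfin := h.finite
  set T := hfin.toFinset with hT
  have hTm : ∀ x, x ∈ T ↔ G 1 x - c * G 0 x = 0 := by intro x; simp [hT]
  have hcard : S'.card ≤ (T \ S').card + 1 := by
    apply Finset.card_le_sdiff_of_interleaved
    intro x hx y hy hxy _
    have hx0 : G 0 x = 0 := by
      simp only [hS', Finset.mem_filter] at hx
      exact hS x hx.1 0 hx.2
    have hy0 : G 0 y = 0 := by
      simp only [hS', Finset.mem_filter] at hy
      exact hS y hy.1 0 hy.2
    have hd : ∀ z, HasDerivAt (fun z => Real.exp (-c * z) * G 0 z)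
        (Real.exp (-c * z) * (G 1 z - c * G 0 z)) z := by
      intro z
      have h1 : HasDerivAt (fun z => Real.exp (-c * z)) (Real.exp (-c * z) * (-c)) z := by
        simpa using ((hasDerivAt_id z).const_mul (-c)).exp
      exact (h1.mul (hG z)).congr_deriv (by ring)
    obtain ⟨z, hz, hz0⟩ := exists_hasDerivAt_eq_zero hxy
      (fun z _ => (hd z).continuousAt.continuousWithinAt) (by simp [hx0, hy0]) (fun z _ => hd z)
    refine ⟨z, (hTm z).2 ?_, hz.1, hz.2⟩
    rcases mul_eq_zero.1 hz0 with h | h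
    · exact absurd h (Real.exp_ne_zero _)
    · exact h
  have key := h (S' ∪ (T \ S')) (fun x => if x ∈ S' then m x - 1 else 1) (by
    intro x hx k hk
    by_cases hxS : x ∈ S'
    · simp only [hxS, if_true] at hk
      simp only [hS', Finset.mem_filter] at hxS
      simp [hS x hxS.1 k (by omega), hS x hxS.1 (k+1) (by omega)]
    · simp only [hxS, if_false] at hk
      have : k = 0 := by omega
      subst this
      have : x ∈ T := by
        rcases Finset.mem_union.1 hx with h | h
        · exact absurd h hxS
        · exact (Finset.mem_sdiff.1 h).1
      exact (hTm x).1 this)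
  rw [Finset.sum_union Finset.disjoint_sdiff] at key
  have e1 : ∑ x ∈ S', (if x ∈ S' then m x - 1 else 1) = ∑ x ∈ S', (m x - 1) :=
    Finset.sum_congr rfl (fun x hx => by simp [hx])
  have e2 : ∑ x ∈ T \ S', (if x ∈ S' then m x - 1 else 1) = (T \ S').card := by
    rw [Finset.card_eq_sum_ones]
    exact Finset.sum_congr rfl (fun x hx => by simp [(Finset.mem_sdiff.1 hx).2])
  rw [e1, e2] at key
  have e3 : ∑ x ∈ S, m x = ∑ x ∈ S', m x := by
    rw [hS', Finset.sum_filter]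
    refine Finset.sum_congr rfl (fun x _ => ?_)
    split_ifs <;> omega
  have e4 : ∑ x ∈ S', m x = ∑ x ∈ S', (m x - 1) + S'.card := by
    rw [Finset.card_eq_sum_ones, ← Finset.sum_add_distrib]
    refine Finset.sum_congr rfl (fun x hx => ?_)
    have := (Finset.mem_filter.1 hx).2
    omega
  omega

lemma ZB.mulX {G : ℕ → ℝ → ℝ} {N : ℕ} (h : ZB G N) :
    ZB (fun k x => x * G k x + k * G (k - 1) x) (N + 1) := by
  classical
  intro S m hS
  have key := h S (fun x => if x = 0 then m x - 1 else m x) (by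
    intro x hx k hk
    have hS := hS x hx
    by_cases h0 : x = 0
    · simp only [h0, if_true] at hk
      have := hS (k+1) (by rw [h0]; omega)
      subst h0
      simp only [zero_mul, zero_add, Nat.add_sub_cancel] at this
      rcases mul_eq_zero.1 this with h | h
      · exact absurd h (by positivity)
      · exact h
    · simp only [h0, if_false] at hk
      induction k with
      | zero => simpa [h0] using hS 0 hk
      | succ k ih =>
        have h1 := ih (by omega)
        have h2 := hS (k+1) hk
        simp only [Nat.add_sub_cancel, h1, mul_zero, add_zero] at h2
        exact (mul_eq_zero.1 h2).resolve_left h0)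
  have : ∑ x ∈ S, m x ≤ ∑ x ∈ S, ((if x = 0 then m x - 1 else m x) + if x = 0 then 1 else 0) := by
    refine Finset.sum_le_sum (fun x _ => ?_)
    split_ifs <;> omega
  rw [Finset.sum_add_distrib] at this
  have h2 : ∑ x ∈ S, (if x = (0:ℝ) then 1 else 0) ≤ 1 := by
    rw [Finset.sum_ite_eq']
    split_ifs <;> omega
  omega

lemma hasDerivAt_laplace (P : ℝ → ℝ) (hP : Continuous P) (a b x₀ : ℝ) :
    HasDerivAt (fun x => ∫ t in a..b, P t * Real.exp (t * x))
      (∫ t in a..b, (t * P t) * Real.exp (t * x₀)) x₀ := by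
  refine (intervalIntegral.hasDerivAt_integral_of_dominated_loc_of_deriv_le
    (F := fun x t => P t * Real.exp (t * x)) (F' := fun x t => (t * P t) * Real.exp (t * x))
    (bound := fun t => |t * P t| * Real.exp (|t| * (|x₀| + 1)))
    (Metric.ball_mem_nhds x₀ one_pos) ?_ ?_ ?_ ?_ ?_ ?_).2
  · exact Filter.Eventually.of_forall fun x =>
      (by fun_prop : Continuous fun t => P t * Real.exp (t * x)).aestronglyMeasurable
  · exact (by fun_prop : Continuous fun t => P t * Real.exp (t * x₀)).intervalIntegrable _ _
  · exact (by fun_prop : Continuous fun t => (t * P t) * Real.exp (t * x₀)).aestronglyMeasurable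
  · refine Filter.Eventually.of_forall fun t _ x hx => ?_
    rw [Real.norm_eq_abs, abs_mul, Real.abs_exp]
    refine mul_le_mul_of_nonneg_left (Real.exp_le_exp.2 ?_) (abs_nonneg _)
    have h1 : |x| ≤ |x₀| + 1 := by
      rw [Metric.mem_ball, Real.dist_eq] at hx
      have := abs_sub_abs_le_abs_sub x x₀
      linarith
    calc t * x ≤ |t * x| := le_abs_self _
      _ = |t| * |x| := abs_mul _ _
      _ ≤ _ := mul_le_mul_of_nonneg_left h1 (abs_nonneg _)
  · exact (by fun_prop : Continuous fun t =>
      |t * P t| * Real.exp (|t| * (|x₀| + 1))).intervalIntegrable _ _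
  · refine Filter.Eventually.of_forall fun t _ x _ => ?_
    have h1 : HasDerivAt (fun x => Real.exp (t * x)) (Real.exp (t * x) * t) x := by
      simpa using ((hasDerivAt_id x).const_mul t).exp
    exact (h1.const_mul (P t)).congr_deriv (by ring)

/-- Laplace type transform of a step function times `P`. -/
noncomputable def lap (L : ℕ) (A q : ℕ → ℝ) (P : ℝ → ℝ) (x : ℝ) : ℝ :=
  ∑ j ∈ Finset.range L, A (j + 1) * ∫ t in q (j + 1)..q j, P t * Real.exp (t * x)

/-- The sequence of derivatives of `lap`. -/
noncomputable def lapS (L : ℕ) (A q : ℕ → ℝ) (P : ℝ → ℝ) (k : ℕ) (x : ℝ) : ℝ :=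
  lap L A q (fun t => t ^ k * P t) x

lemma lapS_deriv (L : ℕ) (A q : ℕ → ℝ) (P : ℝ → ℝ) (hP : Continuous P) (k : ℕ) (x : ℝ) :
    HasDerivAt (lapS L A q P k) (lapS L A q P (k + 1) x) x := by
  unfold lapS lap
  refine HasDerivAt.fun_sum fun j _ => HasDerivAt.const_mul _ ?_
  refine (hasDerivAt_laplace (fun t => t ^ k * P t) (by fun_prop) (q (j+1)) (q j) x).congr_deriv ?_
  congr 1
  funext t
  ring

lemma lapS_sub (L : ℕ) (A q : ℕ → ℝ) (P : ℝ → ℝ) (hP : Continuous P) (c : ℝ) :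
    (fun k x => lapS L A q P (k + 1) x - c * lapS L A q P k x) =
      lapS L A q (fun t => P t * (t - c)) := by
  funext k x
  unfold lapS lap
  rw [Finset.mul_sum, ← Finset.sum_sub_distrib]
  refine Finset.sum_congr rfl fun j _ => ?_
  rw [mul_left_comm, ← mul_sub, ← intervalIntegral.integral_const_mul,
    ← intervalIntegral.integral_sub]
  · congr 2
    funext t
    ring
  · exact Continuous.intervalIntegrable (by fun_prop) _ _
  · exact Continuous.intervalIntegrable (by fun_prop) _ _

/-- The polynomial with the prescribed sign changes. -/
noncomputable def chg (e c : ℕ → ℝ) (N : ℕ) (t : ℝ) : ℝ :=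
  ∏ i ∈ Finset.range N, if e i = e (i + 1) then 1 else (t - c i)

lemma chg_succ (e c : ℕ → ℝ) (N : ℕ) (t : ℝ) :
    chg e c (N + 1) t = chg e c N t * if e N = e (N + 1) then 1 else (t - c N) := by
  simp [chg, Finset.prod_range_succ]

lemma chg_cont (e c : ℕ → ℝ) (N : ℕ) : Continuous (chg e c N) := by
  unfold chg
  refine continuous_finsetProd _ fun i _ => ?_
  split_ifs <;> fun_prop

lemma ZB_chg (L : ℕ) (A q e c : ℕ → ℝ) (N : ℕ) :
    ∀ M, ZB (lapS L A q (chg e c N)) M → ZB (lapS L A q (fun _ => 1)) (M + N) := by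
  induction N with
  | zero =>
    intro M h
    have : chg e c 0 = fun _ => 1 := by funext t; simp [chg]
    simpa [this] using h
  | succ N ih =>
    intro M h
    rw [show M + (N + 1) = (M + 1) + N by ring]
    apply ih
    by_cases he : e N = e (N + 1)
    · have : chg e c (N + 1) = chg e c N := by funext t; simp [chg_succ, he]
      rw [this] at h
      exact h.mono (by omega)
    · have : chg e c (N + 1) = fun t => chg e c N t * (t - c N) := by
        funext t; simp [chg_succ, he]
      rw [this, ← lapS_sub _ _ _ _ (chg_cont e c N)] at h
      exact h.rolle (c N) (lapS_deriv L A q _ (chg_cont e c N) 0)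

lemma chg_sign (e c : ℕ → ℝ) (he : ∀ i, e i = 1 ∨ e i = -1) (t : ℝ) (i : ℕ)
    (h1 : ∀ j < i, t ≤ c j) : 0 ≤ e 0 * e i * chg e c i t := by
  induction i with
  | zero => simp [chg]; rcases he 0 with h | h <;> simp [h]
  | succ i ih =>
    have h := ih (fun j hj => h1 j (by omega))
    have ht := h1 i (by omega)
    rw [chg_succ]
    split_ifs with hei
    · rw [← hei]; simpa using h
    · have : e (i + 1) = - e i := by
        rcases he i with h | h <;> rcases he (i+1) with h' | h' <;> simp [h, h'] at hei ⊢
      rw [this]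
      nlinarith [mul_nonneg h (sub_nonneg.2 ht)]

lemma chg_sign' (e c : ℕ → ℝ) (he : ∀ i, e i = 1 ∨ e i = -1) (t : ℝ) (i N : ℕ) (hiN : i ≤ N)
    (h1 : ∀ j < i, t ≤ c j) (h2 : ∀ j, i ≤ j → j < N → c j ≤ t) :
    0 ≤ e 0 * e i * chg e c N t := by
  induction N, hiN using Nat.le_induction with
  | base => exact chg_sign e c he t i h1
  | succ N hN ih =>
    have h := ih (fun j hj hj' => h2 j hj (by omega))
    have ht := h2 N hN (by omega)
    rw [chg_succ, ← mul_assoc]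
    refine mul_nonneg h ?_
    split_ifs <;> linarith

lemma chg_pos (e c : ℕ → ℝ) (t : ℝ) (N : ℕ) (h2 : ∀ j < N, c j < t) : 0 < chg e c N t := by
  unfold chg
  refine Finset.prod_pos fun j hj => ?_
  have := h2 j (Finset.mem_range.1 hj)
  split_ifs <;> linarith

lemma walk_even (b : ℕ → ℝ) (hb : ∀ i, b i = 1 ∨ b i = -1) (i : ℕ) :
    ∃ k : ℤ, ∑ j ∈ Finset.range (2 * i), b j = 2 * k := by
  induction i with
  | zero => exact ⟨0, by simp⟩
  | succ i ih =>
    obtain ⟨k, hk⟩ := ih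
    rw [show 2 * (i + 1) = 2 * i + 1 + 1 by ring, Finset.sum_range_succ, Finset.sum_range_succ, hk]
    rcases hb (2 * i) with h | h <;> rcases hb (2 * i + 1) with h' | h' <;> rw [h, h']
    · exact ⟨k + 1, by push_cast; ring⟩
    · exact ⟨k, by ring⟩
    · exact ⟨k, by ring⟩
    · exact ⟨k - 1, by push_cast; ring⟩

lemma abel (b E : ℕ → ℝ) (k : ℕ) : ∑ j ∈ Finset.range (k + 1), b j * E j =
    (∑ j ∈ Finset.range (k + 1), b j) * E k +
      ∑ j ∈ Finset.range k, (∑ i ∈ Finset.range (j + 1), b i) * (E j - E (j + 1)) := by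
  induction k with
  | zero => simp
  | succ k ih =>
    rw [Finset.sum_range_succ, ih, Finset.sum_range_succ b (k + 1),
      Finset.sum_range_succ (fun j => (∑ i ∈ Finset.range (j + 1), b i) * (E j - E (j + 1))) k]
    ring

lemma mul_int_exp (a b x : ℝ) :
    x * ∫ t in a..b, Real.exp (t * x) = Real.exp (b * x) - Real.exp (a * x) := by
  rw [← intervalIntegral.integral_const_mul]
  refine intervalIntegral.integral_eq_sub_of_hasDerivAt (f := fun t => Real.exp (t * x)) ?_ ?_
  · intro t _
    have : HasDerivAt (fun t => Real.exp (t * x)) (Real.exp (t * x) * x) t := by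
      simpa using ((hasDerivAt_id t).mul_const x).exp
    exact this.congr_deriv (by ring)
  · exact Continuous.intervalIntegrable (by fun_prop) _ _

lemma main_ZB (n : ℕ) (hn : 1 ≤ n) (q b : ℕ → ℝ) (hq : ∀ i j, i < j → j < 2 * n → q j < q i)
    (hb : ∀ i, b i = 1 ∨ b i = -1) :
    ZB (lapS (2 * n - 1) (fun j => ∑ i ∈ Finset.range j, b i) q (fun _ => 1)) (n - 1) := by
  set A : ℕ → ℝ := fun j => ∑ i ∈ Finset.range j, b i with hA
  set e : ℕ → ℝ := fun i => if 0 < A (2 * i + 1) then 1 else -1 with he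
  set c : ℕ → ℝ := fun i => q (2 * i + 1) with hc
  have hq' : ∀ i j, i ≤ j → j < 2 * n → q j ≤ q i := by
    intro i j hij hj
    rcases hij.lt_or_eq with h | h
    · exact (hq i j h hj).le
    · rw [h]
  have he1 : ∀ i, e i = 1 ∨ e i = -1 := by
    intro i; simp only [he]; split_ifs <;> simp
  have heA : ∀ j, 0 ≤ e ((j + 1) / 2) * A (j + 1) := by
    intro j
    obtain ⟨i, hi | hi⟩ : ∃ i, j + 1 = 2 * i + 1 ∨ j + 1 = 2 * i := ⟨(j + 1) / 2, by omega⟩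
    · rw [hi, show (2 * i + 1) / 2 = i by omega]
      simp only [he]
      split_ifs with h <;> linarith
    · rw [hi, show (2 * i) / 2 = i by omega]
      obtain ⟨k, hk⟩ := walk_even b hb i
      have hk' : A (2 * i) = 2 * k := hk
      have hs : A (2 * i + 1) = A (2 * i) + b (2 * i) := by simp [hA, Finset.sum_range_succ]
      simp only [he]
      rw [hs, hk']
      rcases lt_trichotomy k 0 with h | h | h
      · have : (k : ℝ) ≤ -1 := by exact_mod_cast (by omega : k ≤ -1)
        rw [if_neg (by rcases hb (2 * i) with h | h <;> linarith)]
        linarith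
      · simp [h]
      · have : (1 : ℝ) ≤ k := by exact_mod_cast h
        rw [if_pos (by rcases hb (2 * i) with h | h <;> linarith)]
        linarith
  have hpos : ∀ x, 0 < e 0 * lapS (2 * n - 1) A q (chg e c (n - 1)) 0 x := by
    intro x
    unfold lapS lap
    rw [Finset.mul_sum]
    have hterm : ∀ j, e 0 * (A (j + 1) * ∫ t in q (j + 1)..q j,
        t ^ 0 * chg e c (n - 1) t * Real.exp (t * x)) = (e ((j + 1) / 2) * A (j + 1)) *
        ∫ t in q (j + 1)..q j, e 0 * e ((j + 1) / 2) * chg e c (n - 1) t * Real.exp (t * x) := by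
      intro j
      have h2 : e ((j + 1) / 2) * e ((j + 1) / 2) = 1 := by
        rcases he1 ((j + 1) / 2) with h | h <;> rw [h] <;> norm_num
      have h3 : (∫ t in q (j + 1)..q j, e 0 * e ((j + 1) / 2) * chg e c (n - 1) t *
          Real.exp (t * x)) = (e 0 * e ((j + 1) / 2)) * ∫ t in q (j + 1)..q j,
          t ^ 0 * chg e c (n - 1) t * Real.exp (t * x) := by
        rw [← intervalIntegral.integral_const_mul]
        congr 1
        funext t
        ring
      rw [h3]
      linear_combination (-(e 0 * A (j + 1) * ∫ t in q (j + 1)..q j,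
          t ^ 0 * chg e c (n - 1) t * Real.exp (t * x))) * h2
    refine Finset.sum_pos' ?_ ⟨0, Finset.mem_range.2 (by omega), ?_⟩
    · intro j hj
      have hj := Finset.mem_range.1 hj
      rw [hterm]
      refine mul_nonneg (heA j) (intervalIntegral.integral_nonneg
        (hq' j (j + 1) (by omega) (by omega)) ?_)
      intro t ht
      refine mul_nonneg (chg_sign' e c he1 t _ _ (by omega) ?_ ?_) (Real.exp_pos _).le
      · intro i hi
        exact ht.2.trans (hq' _ _ (by omega) (by omega))
      · intro i hi hi'
        exact le_trans (hq' _ _ (by omega) (by omega)) ht.1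
    · rw [← mul_assoc]
      have h0 : 0 < e 0 * A (0 + 1) := by
        have : A 1 = b 0 := by simp [hA]
        simp only [he]
        simp only [mul_zero, zero_add, this]
        rcases hb 0 with h | h <;> rw [h] <;> norm_num
      refine mul_pos h0 ?_
      apply intervalIntegral.intervalIntegral_pos_of_pos_on
      · have := chg_cont e c (n - 1)
        exact Continuous.intervalIntegrable (by fun_prop) _ _
      · intro t ht
        refine mul_pos (mul_pos (by positivity) (chg_pos e c t _ ?_)) (Real.exp_pos _)
        intro j hj
        exact lt_of_le_of_lt (hq' _ _ (by omega) (by omega)) ht.1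
      · exact hq _ _ (by omega) (by omega)
  have hZ : ZB (lapS (2 * n - 1) A q (chg e c (n - 1))) 0 := by
    intro S m hS
    refine le_of_eq (Finset.sum_eq_zero fun x hx => ?_)
    by_contra hm
    have h0 := hS x hx 0 (Nat.pos_of_ne_zero hm)
    have := hpos x
    rw [h0] at this
    simp at this
  simpa using ZB_chg _ A q e c _ 0 hZ

open Classical in
/-- Jameson's theorem: a bipartite generalized Dirichlet polynomial of length `2n`
(coefficients `±1`, exactly `n` of each, distinct exponents) has finitely many real zeros,
and the number of its zeros counted with their orders is at most `n`. -/
theorem bipartite_dirichlet_zeros (n : ℕ) (hn : 1 ≤ n)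
    (p : Fin (2 * n) → ℝ) (hp : ∀ i j : Fin (2 * n), i < j → p j < p i)
    (a : Fin (2 * n) → ℝ) (ha : ∀ j, a j = 1 ∨ a j = -1)
    (hcard : (Finset.univ.filter fun j => a j = 1).card = n) :
    ∃ Z : Finset ℝ,
      (∀ x : ℝ, (∑ j, a j * Real.exp (p j * x)) = 0 ↔ x ∈ Z) ∧
      ∑ x ∈ Z, zeroOrder (fun y => ∑ j, a j * Real.exp (p j * y)) x ≤ n := by
  set q : ℕ → ℝ := fun i => if h : i < 2 * n then p ⟨i, h⟩ else 0 with hq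
  set b : ℕ → ℝ := fun i => if h : i < 2 * n then a ⟨i, h⟩ else 1 with hb
  have hqq : ∀ i j, i < j → j < 2 * n → q j < q i := by
    intro i j hij hj
    simp only [hq, hj, hij.trans hj, dif_pos]
    exact hp _ _ hij
  have hbb : ∀ i, b i = 1 ∨ b i = -1 := by
    intro i
    simp only [hb]
    split_ifs
    · exact ha _
    · simp
  have hsum : ∑ j, a j = 0 := by
    have h1 : ∀ j, a j = 2 * (if a j = 1 then 1 else 0) - 1 := by
      intro j
      rcases ha j with h | h <;> rw [h] <;> norm_num
    rw [Finset.sum_congr rfl (fun j _ => h1 j), Finset.sum_sub_distrib, ← Finset.mul_sum,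
      Finset.sum_boole, hcard]
    simp
  have hbsum : ∑ j ∈ Finset.range (2 * n), b j = 0 := by
    rw [← hsum, Finset.sum_range]
    refine Finset.sum_congr rfl fun j _ => ?_
    simp [hb]
  set G := lapS (2 * n - 1) (fun j => ∑ i ∈ Finset.range j, b i) q (fun _ => 1) with hG
  set H : ℕ → ℝ → ℝ := fun k x => x * G k x + k * G (k - 1) x with hH
  have hZ : ZB H n := by
    have := (main_ZB n hn q b hqq hbb).mulX
    rwa [Nat.sub_add_cancel hn] at this
  have hF : (fun y => ∑ j, a j * Real.exp (p j * y)) = H 0 := by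
    funext x
    have h1 : ∑ j, a j * Real.exp (p j * x) =
        ∑ j ∈ Finset.range (2 * n - 1 + 1), b j * Real.exp (q j * x) := by
      rw [Nat.sub_add_cancel (by omega), Finset.sum_range]
      refine Finset.sum_congr rfl fun j _ => ?_
      simp [hb, hq]
    rw [h1, abel b (fun j => Real.exp (q j * x)), Nat.sub_add_cancel (by omega), hbsum]
    simp only [hH, hG, lapS, lap, Finset.mul_sum]
    simp only [zero_mul, zero_add, pow_zero, one_mul, Nat.cast_zero, Finset.sum_const_zero, add_zero]
    refine Finset.sum_congr rfl fun j _ => ?_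
    rw [← mul_int_exp]
    ring
  have hd : ∀ k x, HasDerivAt (H k) (H (k + 1) x) x := by
    intro k x
    have hg := lapS_deriv (2 * n - 1) (fun j => ∑ i ∈ Finset.range j, b i) q (fun _ => 1)
      continuous_const
    have h1 := (hasDerivAt_id x).mul (hg k x)
    have h2 := (hg (k - 1) x).const_mul (k : ℝ)
    refine (h1.add h2).congr_deriv ?_
    simp only [hH, hG, id]
    rcases k with _ | k
    · simp; ring
    · simp; ring
  have hit : ∀ k, iteratedDeriv k (H 0) = H k := by
    intro k
    induction k with
    | zero => simp
    | succ k ih =>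
      rw [iteratedDeriv_succ, ih]
      funext x
      exact (hd k x).deriv
  rw [hF]
  refine ⟨hZ.finite.toFinset, ?_, ?_⟩
  · intro x
    rw [Set.Finite.mem_toFinset, Set.mem_ofPred_eq, ← hF]
  · refine hZ _ _ ?_
    intro x _ k hk
    have := Nat.notMem_of_lt_sInf hk
    simp only [Set.mem_ofPred_eq, not_not] at this
    rw [← hit k]
    exact this
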